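/- Let n ≥ 1 and t ∈ (−1/2, 1/2). Define q_t : ℂⁿ → ℝ by q_t(w) = −tan(πt)·‖w‖², where ‖·‖ is the Euclidean norm, and let δ_t : ℂⁿ → ℂⁿ be the rotation δ_t(z) = e^{−2πit} z. Then the map z ↦ (z + δ_t(z))/2 is a bijection of ℂⁿ, and for every z ∈ ℂⁿ one has ∇q_t((z + δ_t(z))/2) = i(z − δ_t(z)). In other words, q_t is a generating function of the rotation δ_t. -/

import Mathlib

/-- The gradient of `w ↦ c‖w‖²` is `w ↦ 2cw`. -/
theorem hasGradientAt_const_mul_norm_sq {E : Type*} [NormedAddCommGroup E]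
    [InnerProductSpace ℝ E] [CompleteSpace E] (c : ℝ) (w : E) :
    HasGradientAt (fun x : E => c * ‖x‖ ^ 2) ((2 * c) • w) w := by
  rw [hasGradientAt_iff_hasFDerivAt]
  refine ((hasStrictFDerivAt_norm_sq w).hasFDerivAt.const_mul c).congr_fderiv ?_
  ext v
  simp
  ring

/-- The half-angle factorization of `1 + e^{−2iθ}`. -/
theorem one_add_exp_neg_two_mul_I (θ : ℂ) :
    1 + Complex.exp (-(2 * θ) * Complex.I) =
      2 * Complex.cos θ * Complex.exp (-θ * Complex.I) := by
  rw [Complex.two_cos, add_mul, ← Complex.exp_add, ← Complex.exp_add, ← Complex.exp_zero]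
  ring_nf

/-- The half-angle factorization of `1 - e^{−2iθ}`. -/
theorem one_sub_exp_neg_two_mul_I (θ : ℂ) :
    1 - Complex.exp (-(2 * θ) * Complex.I) =
      2 * Complex.I * Complex.sin θ * Complex.exp (-θ * Complex.I) := by
  have h : 2 * Complex.I * Complex.sin θ =
      Complex.exp (θ * Complex.I) - Complex.exp (-θ * Complex.I) := by
    linear_combination Complex.I * Complex.two_sin θ +
      (Complex.exp (-θ * Complex.I) - Complex.exp (θ * Complex.I)) * Complex.I_sq
  rw [h, sub_mul, ← Complex.exp_add, ← Complex.exp_add, ← Complex.exp_zero]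
  ring_nf


/-- `ℂⁿ` with its Euclidean structure. -/
noncomputable abbrev Cn (n : ℕ) := EuclideanSpace ℂ (Fin n)

/-- For `t ∈ (−1/2, 1/2)`, the quadratic form `q_t(w) = −tan(πt)‖w‖²` is a generating
function of the rotation `δ_t : z ↦ e^{−2πit} z` of `ℂⁿ`: the map `z ↦ (z + δ_t(z))/2` is a
bijection of `ℂⁿ` and `∇q_t((z + δ_t(z))/2) = i(z − δ_t(z))` for all `z`. -/
theorem rotation_generating_function (n : ℕ) (hn : 1 ≤ n)
    (t : ℝ) (ht : t ∈ Set.Ioo (-(1/2) : ℝ) (1/2))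
    (q : Cn n → ℝ) (hq : q = fun w => -Real.tan (Real.pi * t) * ‖w‖ ^ 2)
    (δ : Cn n → Cn n)
    (hδ : δ = fun z => Complex.exp (-(2 * Real.pi * t) * Complex.I) • z) :
    Function.Bijective (fun z : Cn n => (2:ℝ)⁻¹ • (z + δ z)) ∧
      ∀ z : Cn n, gradient q ((2:ℝ)⁻¹ • (z + δ z)) = Complex.I • (z - δ z) := by
  subst hq hδ
  set θ : ℝ := Real.pi * t with hθ
  have hcos : Real.cos θ ≠ 0 := by
    refine (Real.cos_pos_of_mem_Ioo ⟨?_, ?_⟩).ne' <;>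
      nlinarith [Real.pi_pos, ht.1, ht.2]
  have hexp : -(2 * Real.pi * t) * Complex.I = -(2 * (θ : ℂ)) * Complex.I := by
    rw [hθ]
    push_cast
    ring
  have hmid (z : Cn n) : (2 : ℝ)⁻¹ • (z + Complex.exp (-(2 * Real.pi * t) * Complex.I) • z) =
      ((Real.cos θ : ℂ) * Complex.exp (-θ * Complex.I)) • z := by
    rw [hexp]
    ext j
    simp only [PiLp.smul_apply, PiLp.add_apply, smul_eq_mul, Complex.real_smul]
    push_cast
    linear_combination (z j / 2) * one_add_exp_neg_two_mul_I θ
  simp only [hmid]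
  refine ⟨MulAction.bijective₀
    (mul_ne_zero (Complex.ofReal_ne_zero.mpr hcos) (Complex.exp_ne_zero _)), fun z => ?_⟩
  rw [(hasGradientAt_const_mul_norm_sq _ _).gradient, hexp]
  have htan : (Real.tan θ : ℂ) * Complex.cos θ = Complex.sin θ := by
    exact_mod_cast Real.tan_mul_cos hcos
  ext j
  simp only [PiLp.smul_apply, PiLp.sub_apply, smul_eq_mul, Complex.real_smul]
  push_cast at htan ⊢
  linear_combination (-2 * Complex.exp (-θ * Complex.I) * z j) * htan -
    (Complex.I * z j) * one_sub_exp_neg_two_mul_I θ -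
    2 * Complex.sin θ * Complex.exp (-θ * Complex.I) * z j * Complex.I_sq
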